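/- Let f : Ω_{κ,n} → ℝ be symmetric (i.e. f(σω) = f(ω) for all σ ∈ S_n acting by permuting coordinates) and satisfy |f(ω) − f(ω_1', ω_2, …, ω_n)| ≤ c for all ω ∈ Ω_{κ,n} and all admissible ω_1' ∈ 𝒳, for some c > 0. Then for every t ≥ 0, P_{κ,n}(f − E_{κ,n} f ≥ t) ≤ exp(− t² / (4 (1 − n/N) c² n)). -/

import Mathlib

open Finset Real
open scoped Classical

noncomputable section

/-- The multislice `Ω_κ ⊆ 𝒳^N`: vectors with values in `{x ℓ}` where the value `x ℓ`
appears exactly `κ ℓ` times. -/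
def multislice (L N : ℕ) (κ : Fin L → ℕ) (x : Fin L → ℝ) : Finset (Fin N → ℝ) :=
  (Fintype.piFinset fun _ : Fin N => Finset.image x Finset.univ).filter
    (fun ω => ∀ ℓ : Fin L, (Finset.univ.filter fun i => ω i = x ℓ).card = κ ℓ)

/-- Expectation with respect to the uniform distribution on a finite set. -/
def uexpect {α : Type*} (Ω : Finset α) (f : α → ℝ) : ℝ := (∑ ω ∈ Ω, f ω) / Ω.card

/-- Probability of an event with respect to the uniform distribution on a finite set. -/
def uprob {α : Type*} (Ω : Finset α) (p : α → Prop) : ℝ :=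
  ((Ω.filter p).card : ℝ) / Ω.card

/-- `Ω_{κ,n}`: the image of the multislice under the projection onto the first `n`
coordinates (`n` out of `N` sampling without replacement). -/
def msProj (L N n : ℕ) (κ : Fin L → ℕ) (x : Fin L → ℝ) (hn : n ≤ N) :
    Finset (Fin n → ℝ) :=
  (multislice L N κ x).image (fun ω => fun i : Fin n => ω (Fin.castLE hn i))

/-- Expectation `E_{κ,n}` with respect to `P_{κ,n}`, the push-forward of the uniform
distribution `P_κ` on the multislice under the projection onto the first `n` coordinates. -/
def msExpectN (L N n : ℕ) (κ : Fin L → ℕ) (x : Fin L → ℝ) (hn : n ≤ N)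
    (f : (Fin n → ℝ) → ℝ) : ℝ :=
  uexpect (multislice L N κ x) (fun ω => f (fun i : Fin n => ω (Fin.castLE hn i)))

/-- Probability `P_{κ,n}` of an event, i.e. the push-forward of the uniform distribution
`P_κ` on the multislice under the projection onto the first `n` coordinates. -/
def msProbN (L N n : ℕ) (κ : Fin L → ℕ) (x : Fin L → ℝ) (hn : n ≤ N)
    (p : (Fin n → ℝ) → Prop) : ℝ :=
  uprob (multislice L N κ x) (fun ω => p (fun i : Fin n => ω (Fin.castLE hn i)))

lemma uexpect_mono {α : Type*} {A : Finset α} {f g : α → ℝ} (h : ∀ a ∈ A, f a ≤ g a) :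
    uexpect A f ≤ uexpect A g :=
  div_le_div_of_nonneg_right (Finset.sum_le_sum h) (Nat.cast_nonneg _)

lemma uexpect_mul_const {α : Type*} (A : Finset α) (f : α → ℝ) (r : ℝ) :
    uexpect A (fun a => f a * r) = uexpect A f * r := by
  rw [uexpect, uexpect, ← Finset.sum_mul, mul_div_right_comm]

lemma exp_mul_le_of_abs_le {d u s : ℝ} (hd : 0 < d) (hu : |u| ≤ d) :
    Real.exp (s * u) ≤ Real.cosh (s * d) + u * (Real.sinh (s * d) / d) := by
  obtain ⟨h1, h2⟩ := abs_le.1 hu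
  have key := convexOn_exp.2 (Set.mem_univ (s * d)) (Set.mem_univ (-(s * d)))
    (show 0 ≤ (1 + u / d) / 2 by
        have : -1 ≤ u / d := by rw [le_div_iff₀ hd]; linarith
        linarith)
    (show 0 ≤ (1 - u / d) / 2 by
        have : u / d ≤ 1 := by rw [div_le_iff₀ hd]; linarith
        linarith) (by ring)
  simp only [smul_eq_mul] at key
  have e1 : (1 + u / d) / 2 * (s * d) + (1 - u / d) / 2 * -(s * d) = s * u := by
    field_simp; ring
  rw [e1] at key
  refine key.trans (le_of_eq ?_)
  rw [Real.cosh_eq, Real.sinh_eq]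
  field_simp
  ring

/-- A finite form of Hoeffding's lemma. -/
lemma uexpect_exp_le {α : Type*} {A : Finset α} (hA : A.Nonempty) {y : α → ℝ} {d : ℝ}
    (hd : 0 < d) (hy : ∀ a ∈ A, ∀ b ∈ A, |y a - y b| ≤ d) (s : ℝ) :
    uexpect A (fun a => Real.exp (s * y a)) ≤
      Real.exp (s * uexpect A y + s ^ 2 * d ^ 2 / 2) := by
  have hcard : (0 : ℝ) < A.card := by exact_mod_cast hA.card_pos
  set μ := uexpect A y with hμ
  have hsum : ∑ a ∈ A, (y a - μ) = 0 := by
    rw [Finset.sum_sub_distrib, Finset.sum_const, nsmul_eq_mul, hμ, uexpect,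
      mul_div_cancel₀ _ hcard.ne', sub_self]
  have hdev : ∀ a ∈ A, |y a - μ| ≤ d := by
    intro a ha
    have h1 : y a - μ = (∑ b ∈ A, (y a - y b)) / A.card := by
      rw [Finset.sum_sub_distrib, Finset.sum_const, nsmul_eq_mul, hμ, uexpect]
      field_simp
    rw [h1, abs_div, abs_of_pos hcard, div_le_iff₀ hcard]
    refine (Finset.abs_sum_le_sum_abs _ _).trans ?_
    refine (Finset.sum_le_card_nsmul _ _ d fun b hb => hy a ha b hb).trans (le_of_eq ?_)
    rw [nsmul_eq_mul, mul_comm]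
  have hexp : uexpect A (fun a => Real.exp (s * (y a - μ))) ≤ Real.cosh (s * d) := by
    rw [uexpect, div_le_iff₀ hcard]
    refine (Finset.sum_le_sum fun a ha => exp_mul_le_of_abs_le hd (hdev a ha)).trans ?_
    rw [Finset.sum_add_distrib, ← Finset.sum_mul, hsum, Finset.sum_const, nsmul_eq_mul]
    linarith
  have hsplit : (fun a => Real.exp (s * y a)) =
      fun a => Real.exp (s * (y a - μ)) * Real.exp (s * μ) := by
    funext a; rw [← Real.exp_add]; ring_nf
  rw [hsplit, uexpect_mul_const, add_comm, Real.exp_add]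
  refine mul_le_mul_of_nonneg_right (hexp.trans ((Real.cosh_le_exp_half_sq _).trans ?_))
    (Real.exp_pos _).le
  rw [mul_pow]

lemma uexpect_powersetCard_succ {α : Type*} [DecidableEq α] (A : Finset α) (n k : ℕ)
    (hA : A.card = k + 1) (G : Finset α → ℝ) :
    uexpect (A.powersetCard (n + 1)) G =
      uexpect A (fun a => uexpect ((A.erase a).powersetCard n) fun S => G (insert a S)) := by
  have hsum : ∑ a ∈ A, ∑ S ∈ (A.erase a).powersetCard n, G (insert a S) =
      (n + 1 : ℝ) * ∑ T ∈ A.powersetCard (n + 1), G T := by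
    have h2 : (n + 1 : ℝ) * ∑ T ∈ A.powersetCard (n + 1), G T =
        ∑ T ∈ A.powersetCard (n + 1), ∑ _a ∈ T, G T := by
      rw [Finset.mul_sum]
      refine Finset.sum_congr rfl fun T hT => ?_
      rw [Finset.sum_const, (Finset.mem_powersetCard.1 hT).2, nsmul_eq_mul]
      push_cast; rfl
    rw [h2, Finset.sum_sigma', Finset.sum_sigma']
    refine Finset.sum_bij' (fun p _ => ⟨insert p.1 p.2, p.1⟩) (fun q _ => ⟨q.2, q.1.erase q.2⟩)
      ?_ ?_ ?_ ?_ ?_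
    · rintro ⟨a, S⟩ h
      simp only [Finset.mem_sigma, Finset.mem_powersetCard] at h ⊢
      have ha : a ∉ S := fun h' => by simpa using h.2.1 h'
      refine ⟨⟨?_, ?_⟩, by simp⟩
      · exact Finset.insert_subset h.1 (h.2.1.trans (Finset.erase_subset _ _))
      · rw [Finset.card_insert_of_notMem ha, h.2.2]
    · rintro ⟨T, a⟩ h
      simp only [Finset.mem_sigma, Finset.mem_powersetCard] at h ⊢
      refine ⟨h.1.1 h.2, Finset.erase_subset_erase _ h.1.1, ?_⟩
      rw [Finset.card_erase_of_mem h.2, h.1.2]; rfl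
    · rintro ⟨a, S⟩ h
      simp only [Finset.mem_sigma, Finset.mem_powersetCard] at h
      have ha : a ∉ S := fun h' => by simpa using h.2.1 h'
      simp [Finset.erase_insert ha]
    · rintro ⟨T, a⟩ h
      simp only [Finset.mem_sigma] at h
      simp [Finset.insert_erase h.2]
    · rintro ⟨a, S⟩ h
      rfl
  have hinner : uexpect A (fun a => uexpect ((A.erase a).powersetCard n)
      fun S => G (insert a S)) =
      (∑ a ∈ A, ∑ S ∈ (A.erase a).powersetCard n, G (insert a S)) /
        (k.choose n * (k + 1 : ℝ)) := by
    unfold uexpect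
    rw [← div_div, Finset.sum_div _ _ (k.choose n : ℝ), hA, Nat.cast_add_one]
    congr 1
    refine Finset.sum_congr rfl fun a ha => ?_
    beta_reduce
    rw [Finset.card_powersetCard, Finset.card_erase_of_mem ha, hA, Nat.add_sub_cancel]
  rw [hinner, hsum, uexpect, Finset.card_powersetCard, hA]
  have hch : ((k + 1 : ℝ)) * k.choose n = (k + 1).choose (n + 1) * (n + 1 : ℝ) := by
    exact_mod_cast Nat.add_one_mul_choose_eq k n
  rw [mul_comm (k.choose n : ℝ), hch, mul_comm ((n : ℝ) + 1), mul_div_mul_right _ _ (by positivity)]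

lemma sum_powersetCard_insert_sub {α : Type*} [DecidableEq α] (A : Finset α) (n : ℕ)
    {a b : α} (ha : a ∈ A) (hb : b ∈ A) (hab : a ≠ b) (F : Finset α → ℝ) :
    ∑ S ∈ (A.erase a).powersetCard n, F (insert a S) -
      ∑ S ∈ (A.erase b).powersetCard n, F (insert b S) =
    ∑ S ∈ ((A.erase a).erase b).powersetCard n, (F (insert a S) - F (insert b S)) := by
  set D := (A.erase a).erase b with hD
  have hbD : b ∉ D := by simp [hD]
  have haD : a ∉ D := by simp [hD]
  have h1 : A.erase a = insert b D := by
    rw [hD, Finset.insert_erase]; simp [hb, hab.symm]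
  have h2 : A.erase b = insert a D := by
    rw [hD, Finset.erase_right_comm, Finset.insert_erase]; simp [ha, hab]
  have split : ∀ (k : ℕ) (d : α) (G : Finset α → ℝ), d ∉ D →
      ∑ S ∈ (insert d D).powersetCard (k + 1), G S =
        ∑ S ∈ D.powersetCard (k + 1), G S + ∑ S ∈ D.powersetCard k, G (insert d S) := by
    intro k d G hd
    have hd' : ∀ j : ℕ, ∀ S ∈ D.powersetCard j, d ∉ S := fun j S hS h =>
      hd ((Finset.mem_powersetCard.1 hS).1 h)
    rw [Finset.powersetCard_succ_insert hd, Finset.sum_union, Finset.sum_image (f := G)]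
    · intro S hS T hT h
      rw [← Finset.erase_insert (hd' _ S hS), ← Finset.erase_insert (hd' _ T hT), h]
    · rw [Finset.disjoint_left]
      intro S hS hS'
      obtain ⟨T, -, rfl⟩ := Finset.mem_image.1 hS'
      exact hd' _ _ hS (Finset.mem_insert_self _ _)
  rw [h1, h2]
  cases n with
  | zero => simp
  | succ k =>
    rw [split k b _ hbD, split k a _ haD, Finset.sum_sub_distrib]
    simp_rw [Finset.insert_comm b a]
    ring

lemma abs_uexpect_insert_sub_le {α : Type*} [DecidableEq α] (A : Finset α) (n m : ℕ)
    (hA : A.card = m + 1 + n + 1) {c : ℝ} (hc : 0 ≤ c) (F : Finset α → ℝ)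
    (hF : ∀ T ⊆ A, T.card = n → ∀ a ∈ A, a ∉ T → ∀ b ∈ A, b ∉ T →
      |F (insert a T) - F (insert b T)| ≤ c) {a b : α} (ha : a ∈ A) (hb : b ∈ A) :
    |uexpect ((A.erase a).powersetCard n) (fun S => F (insert a S)) -
      uexpect ((A.erase b).powersetCard n) (fun S => F (insert b S))| ≤
      c * (m + 1) / (m + 1 + n) := by
  by_cases hab : a = b
  · subst hab
    rw [sub_self, abs_zero]
    positivity
  have hca : (A.erase a).card = m + n + 1 := by rw [Finset.card_erase_of_mem ha, hA]; omega
  have hcb : (A.erase b).card = m + n + 1 := by rw [Finset.card_erase_of_mem hb, hA]; omega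
  have hcD : ((A.erase a).erase b).card = m + n := by
    rw [Finset.card_erase_of_mem (by simp [hb, Ne.symm hab]), hca]; rfl
  have hpos : (0 : ℝ) < (m + n + 1).choose n := by
    exact_mod_cast Nat.choose_pos (by omega)
  rw [uexpect, uexpect, Finset.card_powersetCard, Finset.card_powersetCard, hca, hcb, ← sub_div,
    sum_powersetCard_insert_sub A n ha hb hab, abs_div, abs_of_pos hpos, div_le_iff₀ hpos]
  refine (Finset.abs_sum_le_sum_abs _ _).trans
    ((Finset.sum_le_card_nsmul _ _ c fun S hS => ?_).trans (le_of_eq ?_))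
  · obtain ⟨hS, hn⟩ := Finset.mem_powersetCard.1 hS
    refine hF S (hS.trans ((Finset.erase_subset _ _).trans (Finset.erase_subset _ _))) hn
      a ha (fun h => ?_) b hb (fun h => ?_)
    · simpa using hS h
    · simpa using hS h
  · rw [Finset.card_powersetCard, hcD, nsmul_eq_mul]
    have hch : ((m + n).choose n : ℝ) * (m + n + 1) = (m + n + 1).choose n * (m + 1) := by
      have := Nat.choose_mul_succ_eq (m + n) n
      rw [show m + n + 1 - n = m + 1 by omega] at this
      exact_mod_cast this
    field_simp
    linear_combination c * hch

/-- Moment generating function bound for a function of a uniformly random `n`-element subset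
whose value changes by at most `c` when one element is exchanged. -/
lemma uexpect_powersetCard_exp_le {α : Type*} [DecidableEq α] (m : ℕ) {c : ℝ}
    (hc : 0 < c) (s : ℝ) (n : ℕ) :
    ∀ (A : Finset α) (_ : A.card = m + 1 + n) (F : Finset α → ℝ)
      (_ : ∀ T ⊆ A, T.card + 1 = n → ∀ a ∈ A, a ∉ T → ∀ b ∈ A, b ∉ T →
        |F (insert a T) - F (insert b T)| ≤ c),
      uexpect (A.powersetCard n) (fun S => Real.exp (s * F S)) ≤
        Real.exp (s * uexpect (A.powersetCard n) F +
          s ^ 2 * c ^ 2 * ((m + 1) * n / (m + 1 + n))) := by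
  induction n with
  | zero =>
    intro A _ F _
    simp [uexpect]
  | succ n ih =>
    intro A hA F hF
    have hAne : A.Nonempty := Finset.card_pos.1 (by omega)
    rw [uexpect_powersetCard_succ A n _ hA, uexpect_powersetCard_succ A n _ hA F]
    set B : α → ℝ := fun a => uexpect ((A.erase a).powersetCard n) fun S => F (insert a S)
    have hstep : ∀ a ∈ A, uexpect ((A.erase a).powersetCard n)
        (fun S => Real.exp (s * F (insert a S))) ≤
        Real.exp (s * B a) * Real.exp (s ^ 2 * c ^ 2 * ((m + 1) * n / (m + 1 + n))) := by
      intro a ha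
      rw [← Real.exp_add]
      refine ih (A.erase a) (by rw [Finset.card_erase_of_mem ha, hA]; rfl)
        (fun S => F (insert a S)) ?_
      intro T hT hTn u hu huT v hv hvT
      have haT : a ∉ T := fun h => by simpa using hT h
      have hu' := Finset.mem_erase.1 hu
      have hv' := Finset.mem_erase.1 hv
      have := hF (insert a T)
        (Finset.insert_subset ha (hT.trans (Finset.erase_subset _ _)))
        (by rw [Finset.card_insert_of_notMem haT, hTn]) u hu'.2 (by simp [hu'.1, huT])
        v hv'.2 (by simp [hv'.1, hvT])
      rwa [Finset.insert_comm u, Finset.insert_comm v] at this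
    refine (uexpect_mono hstep).trans ?_
    have hB := uexpect_exp_le hAne (y := B) (d := c * (m + 1) / (m + 1 + n)) (by positivity)
      (fun a ha b hb => abs_uexpect_insert_sub_le A n m hA hc.le F
        (fun T hT hTn => hF T hT (by rw [hTn])) ha hb) s
    rw [uexpect_mul_const]
    refine (mul_le_mul_of_nonneg_right hB (Real.exp_pos _).le).trans ?_
    rw [← Real.exp_add, Real.exp_le_exp, add_assoc]
    refine add_le_add le_rfl ?_
    have key : ((m + 1 : ℝ) / (m + 1 + n)) ^ 2 / 2 + (m + 1) * n / (m + 1 + n) ≤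
        (m + 1) * ((n + 1 : ℕ) : ℝ) / (m + 1 + ((n + 1 : ℕ) : ℝ)) := by
      have hm : (0 : ℝ) ≤ m := Nat.cast_nonneg m
      have hn : (0 : ℝ) ≤ n := Nat.cast_nonneg n
      push_cast
      rw [← sub_nonneg]
      have : ((m + 1 : ℝ) * (n + 1) / (m + 1 + (n + 1))) -
          (((m + 1 : ℝ) / (m + 1 + n)) ^ 2 / 2 + (m + 1) * n / (m + 1 + n)) =
          (m + 1) ^ 2 * (m + n) / (2 * (m + 1 + n) ^ 2 * (m + 1 + (n + 1))) := by
        field_simp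
        ring
      rw [this]
      positivity
    calc s ^ 2 * (c * (m + 1) / (m + 1 + n)) ^ 2 / 2 +
          s ^ 2 * c ^ 2 * ((m + 1) * n / (m + 1 + n))
        = s ^ 2 * c ^ 2 * (((m + 1 : ℝ) / (m + 1 + n)) ^ 2 / 2 +
          (m + 1) * n / (m + 1 + n)) := by ring
      _ ≤ _ := mul_le_mul_of_nonneg_left key (by positivity)

lemma comp_perm_mem_multislice {L N : ℕ} {κ : Fin L → ℕ} {x : Fin L → ℝ} {ω : Fin N → ℝ}
    (hω : ω ∈ multislice L N κ x) (σ : Equiv.Perm (Fin N)) : ω ∘ σ ∈ multislice L N κ x := by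
  simp only [multislice, Finset.mem_filter, Fintype.mem_piFinset] at hω ⊢
  refine ⟨fun i => hω.1 (σ i), fun ℓ => ?_⟩
  rw [← hω.2 ℓ]
  exact Finset.card_equiv σ (by simp)

lemma exists_perm_of_mem_multislice {L N : ℕ} {κ : Fin L → ℕ} {x : Fin L → ℝ}
    {ω ω' : Fin N → ℝ} (hω : ω ∈ multislice L N κ x) (hω' : ω' ∈ multislice L N κ x) :
    ∃ σ : Equiv.Perm (Fin N), ω' ∘ σ = ω := by
  simp only [multislice, Finset.mem_filter, Fintype.mem_piFinset] at hω hω'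
  have hfib : ∀ r : ℝ, Nonempty ({i // ω i = r} ≃ {i // ω' i = r}) := by
    intro r
    refine ⟨Fintype.equivOfCardEq ?_⟩
    rw [Fintype.card_subtype, Fintype.card_subtype]
    by_cases hr : r ∈ Finset.image x Finset.univ
    · obtain ⟨ℓ, -, rfl⟩ := Finset.mem_image.1 hr
      rw [hω.2, hω'.2]
    · rw [Finset.filter_false_of_mem, Finset.filter_false_of_mem]
      · exact fun i _ h => hr (h ▸ hω'.1 i)
      · exact fun i _ h => hr (h ▸ hω.1 i)
  exact ⟨Equiv.ofFiberEquiv fun r => (hfib r).some, funext fun i => Equiv.ofFiberEquiv_map _ i⟩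

lemma exists_perm_comp_castLE {N n : ℕ} (hn : n ≤ N) (e : Fin n ↪ Fin N) :
    ∃ σ : Equiv.Perm (Fin N), ∀ i, σ (Fin.castLE hn i) = e i := by
  obtain ⟨σ, hσ⟩ := (Equiv.Perm.isMultiplyPretransitive (Fin N) n).exists_smul_eq
    (Fin.castLEEmb hn) e
  exact ⟨σ, fun i => DFunLike.congr_fun hσ i⟩

lemma comp_embedding_mem_msProj {L N n : ℕ} {κ : Fin L → ℕ} {x : Fin L → ℝ} (hn : n ≤ N)
    {ω : Fin N → ℝ} (hω : ω ∈ multislice L N κ x) (e : Fin n ↪ Fin N) :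
    ω ∘ e ∈ msProj L N n κ x hn := by
  obtain ⟨σ, hσ⟩ := exists_perm_comp_castLE hn e
  refine Finset.mem_image.2 ⟨ω ∘ σ, comp_perm_mem_multislice hω σ, ?_⟩
  funext i
  simp [hσ]

lemma sum_multislice_comp_perm {L N : ℕ} {κ : Fin L → ℕ} {x : Fin L → ℝ}
    (σ : Equiv.Perm (Fin N)) (g : (Fin N → ℝ) → ℝ) :
    ∑ ω ∈ multislice L N κ x, g (ω ∘ σ) = ∑ ω ∈ multislice L N κ x, g ω := by
  refine Finset.sum_bij' (fun ω _ => ω ∘ σ) (fun ω _ => ω ∘ σ.symm)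
    (fun ω hω => comp_perm_mem_multislice hω σ)
    (fun ω hω => comp_perm_mem_multislice hω σ.symm) ?_ ?_ (fun _ _ => rfl)
  · intro ω _; funext i; simp
  · intro ω _; funext i; simp

/-- The value of `f` on the vector obtained by listing the coordinates of `ω` in `S`. -/
def subsetValue {N n : ℕ} (f : (Fin n → ℝ) → ℝ) (ω : Fin N → ℝ) (S : Finset (Fin N)) : ℝ :=
  if h : S.card = n then f (ω ∘ S.orderEmbOfFin h) else 0

lemma subsetValue_map {L N n : ℕ} {κ : Fin L → ℕ} {x : Fin L → ℝ} (hn : n ≤ N)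
    {f : (Fin n → ℝ) → ℝ}
    (hsym : ∀ ω ∈ msProj L N n κ x hn, ∀ σ : Equiv.Perm (Fin n), f (ω ∘ σ) = f ω)
    {ω : Fin N → ℝ} (hω : ω ∈ multislice L N κ x) (e : Fin n ↪ Fin N) :
    subsetValue f ω (Finset.univ.map e) = f (ω ∘ e) := by
  have hcard : (Finset.univ.map e).card = n := by simp
  rw [subsetValue, dif_pos hcard]
  set o := (Finset.univ.map e).orderEmbOfFin hcard
  have ho : ∀ i, ∃ j, e j = o i := fun i => by
    have := Finset.orderEmbOfFin_mem (Finset.univ.map e) hcard i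
    obtain ⟨j, -, hj⟩ := Finset.mem_map.1 this
    exact ⟨j, hj⟩
  choose τ hτ using ho
  have hinj : Function.Injective τ := fun i j hij => o.injective (by rw [← hτ, ← hτ, hij])
  have := hsym (ω ∘ e) (comp_embedding_mem_msProj hn hω e)
    (Equiv.ofBijective τ (Finite.injective_iff_bijective.1 hinj))
  rw [← this]
  congr 1
  funext i
  simp [hτ]

lemma exists_map_univ_eq {N n : ℕ} {S : Finset (Fin N)} (hS : S.card = n) :
    ∃ e : Fin n ↪ Fin N, Finset.univ.map e = S :=
  ⟨(S.orderEmbOfFin hS).toEmbedding, Finset.map_orderEmbOfFin_univ S hS⟩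

lemma uexpect_comp_perm_powersetCard {L N n : ℕ} {κ : Fin L → ℕ} {x : Fin L → ℝ} (hn : n ≤ N)
    {f : (Fin n → ℝ) → ℝ}
    (hsym : ∀ ω ∈ msProj L N n κ x hn, ∀ σ : Equiv.Perm (Fin n), f (ω ∘ σ) = f ω)
    {ω : Fin N → ℝ} (hω : ω ∈ multislice L N κ x) (σ : Equiv.Perm (Fin N)) :
    uexpect (Finset.univ.powersetCard n) (subsetValue f (ω ∘ σ)) =
      uexpect (Finset.univ.powersetCard n) (subsetValue f ω) := by
  unfold uexpect
  congr 1
  refine Finset.sum_bij' (fun S _ => S.map σ.toEmbedding)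
    (fun S _ => S.map σ.symm.toEmbedding) ?_ ?_ ?_ ?_ ?_
  · intro S hS
    simpa using hS
  · intro S hS
    simpa using hS
  · intro S _
    ext; simp
  · intro S _
    ext; simp
  · intro S hS
    obtain ⟨e, rfl⟩ := exists_map_univ_eq (Finset.mem_powersetCard.1 hS).2
    rw [Finset.map_map, subsetValue_map hn hsym (comp_perm_mem_multislice hω σ),
      subsetValue_map hn hsym hω]
    rfl

/-- Averaging over the multislice can be performed by first averaging over all `n`-subsets of
the coordinates. -/
lemma uexpect_multislice_eq {L N n : ℕ} {κ : Fin L → ℕ} {x : Fin L → ℝ} (hn : n ≤ N)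
    {f : (Fin n → ℝ) → ℝ}
    (hsym : ∀ ω ∈ msProj L N n κ x hn, ∀ σ : Equiv.Perm (Fin n), f (ω ∘ σ) = f ω) :
    uexpect (multislice L N κ x) (fun ω => f (fun i => ω (Fin.castLE hn i))) =
      uexpect (multislice L N κ x) (fun ω =>
        uexpect (Finset.univ.powersetCard n) (subsetValue f ω)) := by
  have hpos : (0 : ℝ) < N.choose n := by exact_mod_cast Nat.choose_pos hn
  unfold uexpect
  congr 1
  rw [← Finset.sum_div, Finset.card_powersetCard, Finset.card_univ, Fintype.card_fin,
    eq_div_iff hpos.ne', Finset.sum_comm]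
  have hS : ∀ S ∈ (Finset.univ : Finset (Fin N)).powersetCard n,
      ∑ ω ∈ multislice L N κ x, subsetValue f ω S =
        ∑ ω ∈ multislice L N κ x, f (fun i => ω (Fin.castLE hn i)) := by
    intro S hS
    obtain ⟨e, rfl⟩ := exists_map_univ_eq (Finset.mem_powersetCard.1 hS).2
    obtain ⟨σ, hσ⟩ := exists_perm_comp_castLE hn e
    rw [← sum_multislice_comp_perm σ fun ω => f fun i => ω (Fin.castLE hn i)]
    refine Finset.sum_congr rfl fun ω hω => ?_
    rw [subsetValue_map hn hsym hω]
    congr 1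
    funext i
    simp [hσ]
  rw [Finset.sum_congr rfl hS, Finset.sum_const, Finset.card_powersetCard, Finset.card_univ,
    Fintype.card_fin, nsmul_eq_mul, mul_comm]

lemma abs_subsetValue_insert_sub_le {L N n : ℕ} {κ : Fin L → ℕ} {x : Fin L → ℝ} (hn : n ≤ N)
    (hn1 : 1 ≤ n) {f : (Fin n → ℝ) → ℝ}
    (hsym : ∀ ω ∈ msProj L N n κ x hn, ∀ σ : Equiv.Perm (Fin n), f (ω ∘ σ) = f ω) {c : ℝ}
    (hf : ∀ ω ∈ msProj L N n κ x hn, ∀ ω' ∈ msProj L N n κ x hn,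
      (∀ j : Fin n, j ≠ ⟨0, by omega⟩ → ω' j = ω j) → |f ω - f ω'| ≤ c)
    {ω : Fin N → ℝ} (hω : ω ∈ multislice L N κ x) {T : Finset (Fin N)} (hT : T.card + 1 = n)
    {a b : Fin N} (ha : a ∉ T) (hb : b ∉ T) :
    |subsetValue f ω (insert a T) - subsetValue f ω (insert b T)| ≤ c := by
  obtain ⟨k, rfl⟩ : ∃ k, n = k + 1 := ⟨n - 1, by omega⟩
  obtain ⟨e, rfl⟩ := exists_map_univ_eq (Nat.succ_injective hT)
  have ha' : a ∉ Set.range e := by simpa using ha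
  have hb' : b ∉ Set.range e := by simpa using hb
  have hins : ∀ d, ∀ hd : d ∉ Set.range e, insert d (Finset.univ.map e) =
      Finset.univ.map (⟨Fin.cons d e, Fin.cons_injective_iff.2 ⟨hd, e.injective⟩⟩ :
        Fin (k + 1) ↪ Fin N) := by
    intro d hd
    ext i
    simp [Fin.exists_fin_succ, eq_comm]
  rw [hins a ha', hins b hb', subsetValue_map hn hsym hω, subsetValue_map hn hsym hω]
  refine hf _ (comp_embedding_mem_msProj hn hω _) _ (comp_embedding_mem_msProj hn hω _) ?_
  intro j hj
  obtain ⟨i, rfl⟩ := Fin.exists_succ_eq.2 hj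
  simp

/-- Moment generating function bound for symmetric functions with bounded differences. -/
lemma uexpect_multislice_exp_le {L n : ℕ} {m : ℕ} {κ : Fin L → ℕ} {x : Fin L → ℝ}
    (hn : n ≤ m + 1 + n) (hn1 : 1 ≤ n) {f : (Fin n → ℝ) → ℝ}
    (hsym : ∀ ω ∈ msProj L (m + 1 + n) n κ x hn, ∀ σ : Equiv.Perm (Fin n), f (ω ∘ σ) = f ω)
    {c : ℝ} (hc : 0 < c)
    (hf : ∀ ω ∈ msProj L (m + 1 + n) n κ x hn, ∀ ω' ∈ msProj L (m + 1 + n) n κ x hn,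
      (∀ j : Fin n, j ≠ ⟨0, by omega⟩ → ω' j = ω j) → |f ω - f ω'| ≤ c)
    (hne : (multislice L (m + 1 + n) κ x).Nonempty) (s : ℝ) :
    uexpect (multislice L (m + 1 + n) κ x)
        (fun ω => Real.exp (s * f (fun i => ω (Fin.castLE hn i)))) ≤
      Real.exp (s * msExpectN L (m + 1 + n) n κ x hn f +
        s ^ 2 * c ^ 2 * ((m + 1) * n / (m + 1 + n))) := by
  have hcard : ((multislice L (m + 1 + n) κ x).card : ℝ) ≠ 0 := by
    exact_mod_cast hne.card_pos.ne'
  have hconst : ∀ r : ℝ, uexpect (multislice L (m + 1 + n) κ x) (fun _ => r) = r := by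
    intro r
    rw [uexpect, Finset.sum_const, nsmul_eq_mul, mul_div_cancel_left₀ _ hcard]
  have hmean : ∀ ω ∈ multislice L (m + 1 + n) κ x,
      uexpect (Finset.univ.powersetCard n) (subsetValue f ω) =
        msExpectN L (m + 1 + n) n κ x hn f := by
    intro ω hω
    rw [msExpectN, uexpect_multislice_eq hn hsym, ← hconst (uexpect _ (subsetValue f ω))]
    refine congrArg (· / _) (Finset.sum_congr rfl fun ω' hω' => ?_)
    obtain ⟨σ, rfl⟩ := exists_perm_of_mem_multislice hω hω'
    exact uexpect_comp_perm_powersetCard hn hsym hω' σ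
  rw [uexpect_multislice_eq (f := fun ω => Real.exp (s * f ω)) hn
    (fun ω hω σ => by rw [hsym ω hω σ])]
  refine (uexpect_mono fun ω hω => ?_).trans (hconst _).le
  rw [← hmean ω hω]
  refine le_trans (le_of_eq ?_) (uexpect_powersetCard_exp_le m hc s n Finset.univ (by simp)
    (subsetValue f ω) fun T _ hT a _ ha b _ hb =>
      abs_subsetValue_insert_sub_le hn hn1 hsym hf hω hT ha hb)
  refine congrArg (· / _) (Finset.sum_congr rfl fun S hS => ?_)
  have hS' := (Finset.mem_powersetCard.1 hS).2
  simp only [subsetValue, dif_pos hS']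

/-- Markov's inequality for the exponential of a function on a finite set. -/
lemma uprob_le_exp_mul_uexpect {α : Type*} (Ω : Finset α) (g : α → ℝ) {s : ℝ} (hs : 0 ≤ s)
    (u : ℝ) :
    uprob Ω (fun ω => u ≤ g ω) ≤
      uexpect Ω (fun ω => Real.exp (s * g ω)) * Real.exp (-(s * u)) := by
  rw [← uexpect_mul_const, uprob, uexpect, Finset.card_filter]
  push_cast
  refine div_le_div_of_nonneg_right (Finset.sum_le_sum fun ω _ => ?_) (Nat.cast_nonneg _)
  rw [← Real.exp_add]
  split_ifs with h
  · exact Real.one_le_exp (by nlinarith)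
  · exact (Real.exp_pos _).le

/-- Bounded differences inequality for symmetric functions in sampling without
replacement. -/
theorem stmt5 (L N n : ℕ) (hL : 2 ≤ L) (κ : Fin L → ℕ) (hκ : ∀ ℓ, 1 ≤ κ ℓ)
    (hN : N = ∑ ℓ, κ ℓ) (x : Fin L → ℝ) (hx : StrictMono x) (hn : n ≤ N) (hn1 : 1 ≤ n)
    (f : (Fin n → ℝ) → ℝ)
    (hsym : ∀ ω ∈ msProj L N n κ x hn, ∀ σ : Equiv.Perm (Fin n), f (ω ∘ σ) = f ω)
    (c : ℝ) (hc : 0 < c)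
    (hf : ∀ ω ∈ msProj L N n κ x hn, ∀ ω' ∈ msProj L N n κ x hn,
      (∀ j : Fin n, j ≠ ⟨0, by omega⟩ → ω' j = ω j) → |f ω - f ω'| ≤ c)
    (t : ℝ) (ht : 0 ≤ t) :
    msProbN L N n κ x hn (fun ω => f ω - msExpectN L N n κ x hn f ≥ t) ≤
      Real.exp (-(t ^ 2) / (4 * (1 - (n : ℝ) / N) * c ^ 2 * n)) := by
  rcases hn.eq_or_lt with rfl | hlt
  · have hn0 : (n : ℝ) ≠ 0 := by positivity
    rw [div_self hn0, sub_self, mul_zero, zero_mul, zero_mul, div_zero, Real.exp_zero]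
    exact div_le_one_of_le₀ (by exact_mod_cast Finset.card_filter_le _ _) (Nat.cast_nonneg _)
  obtain ⟨m, rfl⟩ : ∃ m, N = m + 1 + n := ⟨N - n - 1, by omega⟩
  rcases (multislice L (m + 1 + n) κ x).eq_empty_or_nonempty with he | hne
  · simp only [msProbN, uprob, he, Finset.card_empty, Nat.cast_zero, div_zero]
    exact (Real.exp_pos _).le
  set E := msExpectN L (m + 1 + n) n κ x hn f
  have hn0 : (0 : ℝ) < n := by exact_mod_cast hn1
  set s : ℝ := t * (m + 1 + n) / (2 * c ^ 2 * (m + 1) * n) with hs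
  have hs0 : 0 ≤ s := by positivity
  have hmarkov := uprob_le_exp_mul_uexpect (multislice L (m + 1 + n) κ x)
    (fun ω => f (fun i => ω (Fin.castLE hn i))) hs0 (E + t)
  have hmgf := uexpect_multislice_exp_le hn hn1 hsym hc hf hne s
  have hprob : msProbN L (m + 1 + n) n κ x hn (fun ω => f ω - E ≥ t) =
      uprob (multislice L (m + 1 + n) κ x)
        (fun ω => E + t ≤ f (fun i => ω (Fin.castLE hn i))) := by
    rw [msProbN]
    congr 1
    funext ω
    rw [ge_iff_le, le_sub_iff_add_le']
  rw [hprob]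
  refine hmarkov.trans
    ((mul_le_mul_of_nonneg_right hmgf (Real.exp_pos _).le).trans (le_of_eq ?_))
  rw [← Real.exp_add]
  congr 1
  have hfrac : 1 - (n : ℝ) / ((m + 1 + n : ℕ) : ℝ) = (m + 1) / (m + 1 + n) := by
    push_cast
    field_simp
    ring
  rw [hfrac, hs]
  field_simp
  ring
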